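/- arXiv:quant-ph/0310172 — 2 statements merged into one kernel-verified Lean document; each statement's English description precedes it below -/
import Mathlib

section
/- Let S = {|S_1⟩, |S_2⟩, |S_3⟩, |S_4⟩} be a three-qubit unextendible product basis and H_S its span. Then the only product vectors in H_S are scalar multiples of the members |S_j⟩, j = 1,2,3,4. -/
noncomputable section

open Matrix Finset
open scoped ComplexOrder

/-- one-qubit vectors -/
abbrev V2 := Fin 2 → ℂ
/-- index set of the three-qubit space ℂ²⊗ℂ²⊗ℂ² -/
abbrev I8 := Fin 2 × Fin 2 × Fin 2
/-- three-qubit vectors -/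
abbrev V8 := I8 → ℂ
/-- one-qubit operators -/
abbrev M2 := Matrix (Fin 2) (Fin 2) ℂ
/-- three-qubit operators -/
abbrev M8 := Matrix I8 I8 ℂ

/-- inner product on ℂ², conjugate-linear in the first argument -/
def inner2 (u v : V2) : ℂ := ∑ i, star (u i) * v i

/-- inner product on ℂ²⊗ℂ²⊗ℂ², conjugate-linear in the first argument -/
def inner8 (u v : V8) : ℂ := ∑ p, star (u p) * v p

/-- tensor product |a⟩⊗|b⟩⊗|c⟩ of three one-qubit vectors -/
def tp3 (a b c : V2) : V8 := fun p => a p.1 * b p.2.1 * c p.2.2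

/-- Kronecker (tensor) product X_A⊗X_B⊗X_C of three one-qubit operators -/
def kron3 (X Y Z : M2) : M8 :=
  Matrix.of fun p q => X p.1 q.1 * Y p.2.1 q.2.1 * Z p.2.2 q.2.2

/-- a product operator on three qubits -/
def IsProductOp (X : M8) : Prop := ∃ XA XB XC : M2, X = kron3 XA XB XC

/-- the projector |v⟩⟨v| onto a vector -/
def proj8 (v : V8) : M8 := Matrix.vecMulVec v (star v)

/-- A three-qubit unextendible product basis with `n` members: mutually orthonormal
product vectors (products of unit vectors) such that the orthogonal complement of
their span contains no nonzero product vector. -/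
structure UPB (n : ℕ) where
  S : Fin n → V8
  prod : ∀ j, ∃ a b c : V2,
    inner2 a a = 1 ∧ inner2 b b = 1 ∧ inner2 c c = 1 ∧ S j = tp3 a b c
  ortho : ∀ i j, inner8 (S i) (S j) = if i = j then 1 else 0
  unext : ∀ a b c : V2, (∀ j, inner8 (S j) (tp3 a b c) = 0) → tp3 a b c = 0

/-- the bound entangled state ρ_S = (1/(8-n))(I - Σ_j |S_j⟩⟨S_j|) associated with a UPB -/
def upbState {n : ℕ} (U : UPB n) : M8 :=
  ((8 : ℂ) - (n : ℂ))⁻¹ • ((1 : M8) - ∑ j, proj8 (U.S j))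

/-- equivalence of four-member UPBs: related by local unitaries and a permutation of members -/
def UPB.Equiv (S T : UPB 4) : Prop :=
  ∃ UA UB UC : M2, UA ∈ Matrix.unitaryGroup (Fin 2) ℂ ∧
    UB ∈ Matrix.unitaryGroup (Fin 2) ℂ ∧ UC ∈ Matrix.unitaryGroup (Fin 2) ℂ ∧
    ∃ σ : Equiv.Perm (Fin 4), ∀ j, S.S j = (kron3 UA UB UC).mulVec (T.S (σ j))

/-- square root of a positive semidefinite matrix (junk value 0 otherwise) -/
def msqrt {m : Type*} [Fintype m] [DecidableEq m] (A : Matrix m m ℂ) : Matrix m m ℂ :=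
  open scoped Classical in if h : A.PosSemidef then
    (h.1.eigenvectorUnitary : Matrix m m ℂ) *
      Matrix.diagonal (fun i => ((Real.sqrt (h.1.eigenvalues i) : ℝ) : ℂ)) *
      (star h.1.eigenvectorUnitary : Matrix m m ℂ) else 0

/-- fidelity F(ρ,σ) = tr √(√ρ σ √ρ) of positive semidefinite matrices -/
def fidelity {m : Type*} [Fintype m] [DecidableEq m] (ρ σ : Matrix m m ℂ) : ℝ :=
  ((msqrt (msqrt ρ * σ * msqrt ρ)).trace).re

/-- the determinant of two one-qubit vectors, which vanishes exactly on parallel pairs -/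
def det2 (u v : V2) : ℂ := u 0 * v 1 - u 1 * v 0

/-- a one-qubit vector orthogonal to the given one and of the same length -/
def perp2 (u : V2) : V2 := ![-star (u 1), star (u 0)]

lemma det2_self (u : V2) : det2 u u = 0 := by
  simp only [det2]; ring

lemma det2_swap (u v : V2) : det2 u v = -det2 v u := by
  simp only [det2]; ring

lemma inner2_perp2 (u w : V2) : inner2 u (perp2 w) = star (det2 w u) := by
  simp [inner2, perp2, det2, Fin.sum_univ_two]
  ring

lemma inner2_perp2_perp2 (u : V2) : inner2 (perp2 u) (perp2 u) = inner2 u u := by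
  simp [inner2, perp2, Fin.sum_univ_two]
  ring

lemma star_inner2 (u v : V2) : star (inner2 u v) = inner2 v u := by
  simp [inner2, Fin.sum_univ_two]
  ring

lemma inner2_comm_eq_zero {u v : V2} (h : inner2 u v = 0) : inner2 v u = 0 := by
  rw [← star_inner2, h, star_zero]

lemma inner8_tp3 (a b c a' b' c' : V2) :
    inner8 (tp3 a b c) (tp3 a' b' c') = inner2 a a' * inner2 b b' * inner2 c c' := by
  simp [inner8, tp3, inner2, Fintype.sum_prod_type, Fin.sum_univ_two]
  ring

/-- Two vectors orthogonal to the same unit vector are parallel. -/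
lemma det2_eq_zero_of_inner2_eq_zero {u v w : V2} (hu : inner2 u u = 1)
    (hv : inner2 u v = 0) (hw : inner2 u w = 0) : det2 v w = 0 := by
  simp only [inner2, Fin.sum_univ_two] at hu hv hw
  simp only [det2]
  linear_combination (-(v 0 * w 1 - v 1 * w 0)) * hu + (u 0 * w 1 - u 1 * w 0) * hv
    + (u 1 * v 0 - u 0 * v 1) * hw

/-- For unit vectors, the determinant and the inner product are like sine and cosine. -/
lemma normSq_det2_add_normSq_inner2 {u v : V2} (hu : inner2 u u = 1) (hv : inner2 v v = 1) :
    Complex.normSq (det2 u v) + Complex.normSq (inner2 u v) = 1 := by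
  have h : (Complex.normSq (det2 u v) : ℂ) + Complex.normSq (inner2 u v)
      = inner2 u u * inner2 v v := by
    rw [← Complex.mul_conj, ← Complex.mul_conj]
    simp [inner2, det2, Fin.sum_univ_two]
    ring
  rw [hu, hv, mul_one] at h
  exact_mod_cast h

/-- Contraction of a three-qubit vector with the functionals `det2 a`, `det2 b`, `det2 c`. -/
def contract (a b c : V2) : V8 →ₗ[ℂ] ℂ :=
  ∑ p : I8, (perp2 (star a) p.1 * perp2 (star b) p.2.1 * perp2 (star c) p.2.2) • LinearMap.proj p

lemma contract_tp3 (a b c a' b' c' : V2) :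
    contract a b c (tp3 a' b' c') = det2 a a' * det2 b b' * det2 c c' := by
  simp [contract, perp2, tp3, det2, Fintype.sum_prod_type, Fin.sum_univ_two]
  ring

/-- Three parties can be assigned the three indices other than `j`, with a prescribed one
going to a prescribed party. -/
lemma exists_assignment (p : Fin 3) {i j : Fin 4} (hij : i ≠ j) :
    ∃ σ : Fin 3 → Fin 4, σ p = i ∧ (∀ q, σ q ≠ j) ∧ ∀ m, m ≠ j → ∃ q, σ q = m := by
  obtain ⟨s, hs⟩ := Fin.exists_succAbove_eq hij
  refine ⟨j.succAbove ∘ Equiv.swap p s, by simpa using hs, fun q => Fin.succAbove_ne _ _,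
    fun m hm => ?_⟩
  obtain ⟨t, ht⟩ := Fin.exists_succAbove_eq hm
  exact ⟨Equiv.swap p s t, by simpa using ht⟩

/-- In an unextendible product family no two of the local vectors of a party are parallel. -/
lemma det2_ne_zero_of_unext {T : Fin 3 → Fin 4 → V2}
    (hT : ∀ p i, inner2 (T p i) (T p i) = 1)
    (hun : ∀ g : Fin 3 → V2, (∀ j, ∏ p, inner2 (T p j) (g p) = 0) →
      ∏ p, inner2 (g p) (g p) = 0)
    (p : Fin 3) {i j : Fin 4} (hij : i ≠ j) : det2 (T p i) (T p j) ≠ 0 := by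
  intro h
  obtain ⟨σ, rfl, -, hσ⟩ := exists_assignment p hij
  have h0 := hun (fun q => perp2 (T q (σ q))) fun m => by
    simp only [inner2_perp2]
    by_cases hm : m = j
    · exact Finset.prod_eq_zero (mem_univ p) (by rw [hm, h, star_zero])
    · obtain ⟨q, rfl⟩ := hσ m hm
      exact Finset.prod_eq_zero (mem_univ q) (by rw [det2_self, star_zero])
  simp [inner2_perp2_perp2, hT] at h0

/-- If the span of four product vectors contains a product vector in general position, then
the local vectors of two parties have the same cross ratio. -/
lemma cross_ratio_eq {A B C : Fin 4 → V2} {a b c : V2} {x : Fin 4 → ℂ}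
    (hx : ∀ i j k l : Fin 4, i ≠ j → i ≠ k → i ≠ l → j ≠ k → j ≠ l → k ≠ l →
      det2 (A i) a * det2 (B j) b * det2 (C k) c =
        x l * (det2 (A i) (A l) * det2 (B j) (B l) * det2 (C k) (C l)))
    (hA : ∀ i, det2 (A i) a ≠ 0) (hB : ∀ i, det2 (B i) b ≠ 0) (hC : ∀ i, det2 (C i) c ≠ 0) :
    det2 (A 0) (A 1) * det2 (A 2) (A 3) * (det2 (B 0) (B 2) * det2 (B 1) (B 3)) =
      det2 (A 0) (A 2) * det2 (A 1) (A 3) * (det2 (B 0) (B 1) * det2 (B 2) (B 3)) := by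
  have key : ∀ k l : Fin 4, 0 ≠ k → 0 ≠ l → 3 ≠ k → 3 ≠ l → k ≠ l →
      det2 (A 0) a * det2 (B 3) b * (det2 (A 3) (A l) * det2 (B 0) (B l)) =
        det2 (A 3) a * det2 (B 0) b * (det2 (A 0) (A l) * det2 (B 3) (B l)) := by
    intro k l h0k h0l h3k h3l hkl
    apply mul_right_cancel₀ (hC k)
    linear_combination
      (det2 (A 3) (A l) * det2 (B 0) (B l)) * hx 0 3 k l (by decide) h0k h0l h3k h3l hkl
      - (det2 (A 0) (A l) * det2 (B 3) (B l)) * hx 3 0 k l (by decide) h3k h3l h0k h0l hkl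
  have h1 := key 2 1 (by decide) (by decide) (by decide) (by decide) (by decide)
  have h2 := key 1 2 (by decide) (by decide) (by decide) (by decide) (by decide)
  rw [det2_swap (A 3) (A _), det2_swap (B 3) (B _)] at h1 h2
  apply mul_left_cancel₀
    (mul_ne_zero (mul_ne_zero (hA 0) (hB 3)) (mul_ne_zero (hA 3) (hB 0)))
  linear_combination (det2 (A 0) a * det2 (B 3) b * det2 (A 2) (A 3) * det2 (B 0) (B 2)) * h1
    - (det2 (A 0) a * det2 (B 3) b * det2 (A 1) (A 3) * det2 (B 0) (B 1)) * h2

/-- Orthogonality along different perfect matchings separates the cross ratios of two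
quadruples of unit vectors. -/
lemma cross_ratio_ne {A B : Fin 4 → V2}
    (hA : ∀ i, inner2 (A i) (A i) = 1) (hB : ∀ i, inner2 (B i) (B i) = 1)
    (hA12 : det2 (A 1) (A 2) ≠ 0)
    (hA01 : inner2 (A 0) (A 1) = 0) (hA23 : inner2 (A 2) (A 3) = 0)
    (hB02 : inner2 (B 0) (B 2) = 0) (hB13 : inner2 (B 1) (B 3) = 0) :
    det2 (A 0) (A 1) * det2 (A 2) (A 3) * (det2 (B 0) (B 2) * det2 (B 1) (B 3)) ≠
      det2 (A 0) (A 2) * det2 (A 1) (A 3) * (det2 (B 0) (B 1) * det2 (B 2) (B 3)) := by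
  intro h
  have one {u v : V2} (hu : inner2 u u = 1) (hv : inner2 v v = 1) (h : inner2 u v = 0) :
      Complex.normSq (det2 u v) = 1 := by
    simpa [h] using normSq_det2_add_normSq_inner2 hu hv
  have le {u v : V2} (hu : inner2 u u = 1) (hv : inner2 v v = 1) :
      Complex.normSq (det2 u v) ≤ 1 := by
    linarith [normSq_det2_add_normSq_inner2 hu hv, Complex.normSq_nonneg (inner2 u v)]
  have lt : Complex.normSq (det2 (A 0) (A 2)) < 1 := by
    have := Complex.normSq_pos.2 fun h02 : inner2 (A 0) (A 2) = 0 =>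
      hA12 (det2_eq_zero_of_inner2_eq_zero (hA 0) hA01 h02)
    linarith [normSq_det2_add_normSq_inner2 (hA 0) (hA 2)]
  have h' := congrArg Complex.normSq h
  simp only [map_mul] at h'
  rw [one (hA 0) (hA 1) hA01, one (hA 2) (hA 3) hA23, one (hB 0) (hB 2) hB02,
    one (hB 1) (hB 3) hB13] at h'
  have hlt := mul_lt_one_of_nonneg_of_lt_one_left (Complex.normSq_nonneg _) lt
    (le (hA 1) (hA 3))
  have hle := mul_le_one₀ (le (hB 0) (hB 1)) (Complex.normSq_nonneg _) (le (hB 2) (hB 3))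
  have := mul_lt_one_of_nonneg_of_lt_one_left
    (mul_nonneg (Complex.normSq_nonneg _) (Complex.normSq_nonneg _)) hlt hle
  linarith

/-- Among three parties, two have orthogonality relations along different perfect matchings
of the four members, namely `01|23` and `02|13`. -/
lemma exists_orthogonal_matchings {T : Fin 3 → Fin 4 → V2}
    (hT : ∀ p i, inner2 (T p i) (T p i) = 1)
    (hd : ∀ p i j, i ≠ j → det2 (T p i) (T p j) ≠ 0)
    (ho : ∀ i j, i ≠ j → ∃ p, inner2 (T p i) (T p j) = 0) :
    ∃ p q, p ≠ q ∧ inner2 (T p 0) (T p 1) = 0 ∧ inner2 (T p 2) (T p 3) = 0 ∧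
      inner2 (T q 0) (T q 2) = 0 ∧ inner2 (T q 1) (T q 3) = 0 := by
  have excl : ∀ {i j k : Fin 4} {p q : Fin 3}, j ≠ k → inner2 (T p i) (T p j) = 0 →
      inner2 (T q i) (T q k) = 0 → p ≠ q := by
    rintro i j k p _ hjk h1 h2 rfl
    exact hd p j k hjk (det2_eq_zero_of_inner2_eq_zero (hT p i) h1 h2)
  obtain ⟨p, hp⟩ := ho 0 1 (by decide)
  obtain ⟨q, hq⟩ := ho 0 2 (by decide)
  obtain ⟨r, hr⟩ := ho 0 3 (by decide)
  obtain ⟨s, hs⟩ := ho 2 3 (by decide)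
  obtain ⟨t, ht⟩ := ho 1 3 (by decide)
  have hpq := excl (by decide) hp hq
  have hpr := excl (by decide) hp hr
  have hqr := excl (by decide) hq hr
  have hsq := excl (by decide) hs (inner2_comm_eq_zero hq)
  have hsr := excl (by decide) (inner2_comm_eq_zero hs) (inner2_comm_eq_zero hr)
  have htp := excl (by decide) ht (inner2_comm_eq_zero hp)
  have htr := excl (by decide) (inner2_comm_eq_zero ht) (inner2_comm_eq_zero hr)
  obtain rfl : s = p := by omega
  obtain rfl : t = q := by omega
  exact ⟨s, t, hpq, hp, hs, hq, ht⟩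

/-- the only product vectors in the span of a three-qubit UPB are
scalar multiples of its members. -/
theorem stmt4 (S : UPB 4) (v : V8)
    (hv : v ∈ Submodule.span ℂ (Set.range S.S))
    (hprod : ∃ a b c : V2, v = tp3 a b c) :
    ∃ (j : Fin 4) (z : ℂ), v = z • S.S j := by
  obtain ⟨a, b, c, rfl⟩ := hprod
  obtain ⟨x, hx⟩ := (Submodule.mem_span_range_iff_exists_fun ℂ).1 hv
  choose A B C hA hB hC hS using S.prod
  set T : Fin 3 → Fin 4 → V2 := ![A, B, C] with hTdef
  set f : Fin 3 → V2 := ![a, b, c] with hfdef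
  have hT : ∀ p i, inner2 (T p i) (T p i) = 1 := by
    intro p i
    fin_cases p <;> simp [hTdef, hA, hB, hC]
  have hd : ∀ p i j, i ≠ j → det2 (T p i) (T p j) ≠ 0 := by
    intro p i j hij
    refine det2_ne_zero_of_unext hT (fun g hg => ?_) p hij
    have h0 := S.unext (g 0) (g 1) (g 2) fun j => by
      simpa [hS, inner8_tp3, Fin.prod_univ_three, hTdef] using hg j
    have h1 := inner8_tp3 (g 0) (g 1) (g 2) (g 0) (g 1) (g 2)
    rw [h0] at h1
    simpa [inner8, Fin.prod_univ_three] using h1.symm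
  have ho : ∀ i j, i ≠ j → ∃ p, inner2 (T p i) (T p j) = 0 := by
    intro i j hij
    have h := S.ortho i j
    rw [if_neg hij, hS, hS, inner8_tp3] at h
    rcases mul_eq_zero.1 h with h | h
    · rcases mul_eq_zero.1 h with h | h
      · exact ⟨0, h⟩
      · exact ⟨1, h⟩
    · exact ⟨2, h⟩
  have hrel : ∀ (σ : Fin 3 → Fin 4) (l : Fin 4), (∀ m, m ≠ l → ∃ q, σ q = m) →
      ∏ p, det2 (T p (σ p)) (f p) = x l * ∏ p, det2 (T p (σ p)) (T p l) := by
    intro σ l hσ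
    have h := congrArg
      (contract (T 0 (σ 0)) (T 1 (σ 1)) (T 2 (σ 2))) hx
    have hS' : ∀ m, S.S m = tp3 (T 0 m) (T 1 m) (T 2 m) := hS
    simp only [map_sum, map_smul, hS', contract_tp3, smul_eq_mul] at h
    rw [Finset.sum_eq_single l] at h
    · rw [Fin.prod_univ_three, Fin.prod_univ_three]
      exact h.symm
    · intro m _ hm
      obtain ⟨q, rfl⟩ := hσ m hm
      fin_cases q <;> simp [det2_self]
    · simp
  by_cases hpar : ∃ p i, det2 (T p i) (f p) = 0
  · obtain ⟨p, i, hpi⟩ := hpar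
    refine ⟨i, x i, ?_⟩
    rw [← hx]
    refine Finset.sum_eq_single i (fun l _ hl => ?_) (by simp)
    obtain ⟨σ, rfl, hne, hσ⟩ := exists_assignment p hl.symm
    have h := hrel σ l hσ
    rw [Finset.prod_eq_zero (mem_univ p) hpi] at h
    rw [(mul_eq_zero.1 h.symm).resolve_right
      (Finset.prod_ne_zero_iff.2 fun q _ => hd q _ _ (hne q)), zero_smul]
  · push Not at hpar
    obtain ⟨p, q, hpq, h01, h23, h02, h13⟩ := exists_orthogonal_matchings hT hd ho
    obtain ⟨r, hrp, hrq, huniv⟩ :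
        ∃ r, r ≠ p ∧ r ≠ q ∧ (univ : Finset (Fin 3)) = {p, q, r} := by
      clear * - hpq
      revert p q; decide
    have hprod3 : ∀ F : Fin 3 → ℂ, ∏ s, F s = F p * F q * F r := by
      intro F
      rw [huniv, prod_insert (by simp [hpq, hrp.symm]), prod_pair hrq.symm, mul_assoc]
    refine absurd (cross_ratio_eq (x := x) ?_ (hpar p) (hpar q) (hpar r))
      (cross_ratio_ne (hT p) (hT q) (hd p 1 2 (by decide)) h01 h23 h02 h13)
    intro i j k l hij hik hil hjk hjl hkl
    have h := hrel (fun s => if s = p then i else if s = q then j else k) l fun m hm => by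
      have : m = i ∨ m = j ∨ m = k := by omega
      rcases this with rfl | rfl | rfl
      · exact ⟨p, by simp⟩
      · exact ⟨q, by simp [hpq.symm]⟩
      · exact ⟨r, by simp [hrp, hrq]⟩
    simpa [hprod3, hpq.symm, hrp, hrq] using h
end
end

section
/- Let S be a three-qubit unextendible product basis with associated state ρ_S, and let M_S = { Xρ_S X† / tr(Xρ_S X†) : X = X_A⊗X_B⊗X_C a product operator with tr(Xρ_S X†) > 0 }. If {Y_n}_{n≥0} is a sequence in M_S converging to an operator Ŷ, then either Ŷ ∈ M_S or Ŷ is a separable state (a convex combination of projectors onto product vectors |a⟩⊗|b⟩⊗|c⟩). -/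
noncomputable section

open Matrix Finset
open scoped ComplexOrder

/-- the set M_S of states obtainable from ρ_S by local filtering operations -/
def MS (S : UPB 4) : Set M8 :=
  { ρ | ∃ X : M8, IsProductOp X ∧ 0 < ((X * upbState S * Xᴴ).trace).re ∧
      ρ = ((X * upbState S * Xᴴ).trace)⁻¹ • (X * upbState S * Xᴴ) }

/-- a separable three-qubit state: a convex combination of projectors onto
(normalized) product vectors -/
def IsSeparable8 (ρ : M8) : Prop :=
  ∃ (k : ℕ) (p : Fin k → ℝ) (a b c : Fin k → V2),
    (∀ i, 0 ≤ p i) ∧ (∑ i, p i) = 1 ∧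
    (∀ i, inner2 (a i) (a i) = 1 ∧ inner2 (b i) (b i) = 1 ∧ inner2 (c i) (c i) = 1) ∧
    ρ = ∑ i, (p i : ℂ) • proj8 (tp3 (a i) (b i) (c i))

/-! ### One-qubit vectors -/

/-- the vector orthogonal to `u`, of the same norm -/
def perp (u : V2) : V2 := ![-star (u 1), star (u 0)]

lemma inner2_perp_self (u : V2) : inner2 u (perp u) = 0 := by
  simp [inner2, perp, Fin.sum_univ_two]; ring

lemma inner2_perp_perp (u : V2) : inner2 (perp u) (perp u) = inner2 u u := by
  simp [inner2, perp, Fin.sum_univ_two]; ring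

lemma inner2_perp_swap (u v : V2) : inner2 (perp u) v = -inner2 (perp v) u := by
  simp [inner2, perp, Fin.sum_univ_two]; ring

lemma inner2_perp_perp_self (u : V2) : inner2 (perp (perp u)) u = -inner2 u u := by
  simp [inner2, perp, Fin.sum_univ_two]; ring

lemma inner2_self_eq (u : V2) :
    inner2 u u = ((Complex.normSq (u 0) + Complex.normSq (u 1) : ℝ) : ℂ) := by
  simp [inner2, Fin.sum_univ_two, Complex.normSq_eq_conj_mul_self]

lemma inner2_self_eq_zero {u : V2} : inner2 u u = 0 ↔ u = 0 := by
  constructor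
  · intro h
    rw [inner2_self_eq, Complex.ofReal_eq_zero] at h
    have h0 := Complex.normSq_nonneg (u 0)
    have h1 := Complex.normSq_nonneg (u 1)
    have e0 : Complex.normSq (u 0) = 0 := by linarith
    have e1 : Complex.normSq (u 1) = 0 := by linarith
    ext i
    fin_cases i
    · simpa using e0
    · simpa using e1
  · rintro rfl
    simp [inner2]

lemma perp_eq_zero {u : V2} : perp u = 0 ↔ u = 0 := by
  rw [← inner2_self_eq_zero, inner2_perp_perp, inner2_self_eq_zero]

/-- Lagrange's identity on `ℂ²`. -/
lemma inner2_lagrange (u v : V2) :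
    inner2 u u * inner2 v v - inner2 u v * inner2 v u =
      inner2 (perp u) v * star (inner2 (perp u) v) := by
  simp [inner2, perp, Fin.sum_univ_two]; ring

/-- Vectors with a common nonzero orthogonal vector are parallel. -/
lemma inner2_perp_eq_zero_of_common {u v w : V2} (hu : u ≠ 0)
    (hv : inner2 u v = 0) (hw : inner2 u w = 0) : inner2 (perp v) w = 0 := by
  simp only [inner2, perp, Fin.sum_univ_two, Matrix.cons_val_zero, Matrix.cons_val_one,
    star_neg, star_star] at *
  have e0 : star (u 0) * (-v 1 * w 0 + v 0 * w 1) = 0 := by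
    linear_combination w 1 * hv - v 1 * hw
  have e1 : star (u 1) * (-v 1 * w 0 + v 0 * w 1) = 0 := by
    linear_combination -w 0 * hv + v 0 * hw
  by_contra h
  refine hu (funext fun i => ?_)
  fin_cases i
  · simpa using (mul_eq_zero.1 e0).resolve_right h
  · simpa using (mul_eq_zero.1 e1).resolve_right h

lemma inner2_mulVec (M : M2) (u v : V2) : inner2 u (M *ᵥ v) = inner2 (Mᴴ *ᵥ u) v := by
  simp [inner2, Fin.sum_univ_two, Matrix.mulVec, dotProduct]; ring

/-! ### Local structure of a four-member unextendible product basis -/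

/-- The local vectors of a four-member unextendible product basis. -/
structure LocalUPB (A B C : Fin 4 → V2) : Prop where
  normA : ∀ i, inner2 (A i) (A i) = 1
  normB : ∀ i, inner2 (B i) (B i) = 1
  normC : ∀ i, inner2 (C i) (C i) = 1
  orth : ∀ i j, i ≠ j → inner2 (A i) (A j) = 0 ∨ inner2 (B i) (B j) = 0 ∨ inner2 (C i) (C j) = 0
  unext : ∀ a b c, (∀ j, inner2 (A j) a = 0 ∨ inner2 (B j) b = 0 ∨ inner2 (C j) c = 0) →
    a = 0 ∨ b = 0 ∨ c = 0

namespace LocalUPB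

variable {A B C : Fin 4 → V2}

lemma rotate (h : LocalUPB A B C) : LocalUPB B C A where
  normA := h.normB
  normB := h.normC
  normC := h.normA
  orth i j hij := by have := h.orth i j hij; tauto
  unext a b c hj := by
    have := h.unext c a b fun j => by have := hj j; tauto
    tauto

lemma ne_zero (h : LocalUPB A B C) (i : Fin 4) : A i ≠ 0 := by
  intro h0
  have := h.normA i
  rw [inner2_self_eq_zero.2 h0] at this
  exact zero_ne_one this

/-- Two distinct members have non-parallel local vectors. -/
lemma eq_of_parallel (h : LocalUPB A B C) {i j : Fin 4} (hij : inner2 (perp (A i)) (A j) = 0) :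
    i = j := by
  by_contra hne
  obtain ⟨k, l, hkl⟩ : ∃ k l : Fin 4, ∀ m, m = i ∨ m = j ∨ m = k ∨ m = l := by
    clear hij
    revert i j; decide
  have := h.unext (perp (A i)) (perp (B k)) (perp (C l)) fun m => by
    rcases hkl m with rfl | rfl | rfl | rfl
    · exact Or.inl (inner2_perp_self _)
    · exact Or.inl (inner2_comm_eq_zero hij)
    · exact Or.inr (Or.inl (inner2_perp_self _))
    · exact Or.inr (Or.inr (inner2_perp_self _))
  simp only [perp_eq_zero] at this
  rcases this with h0 | h0 | h0
  · exact h.ne_zero _ h0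
  · exact h.rotate.ne_zero _ h0
  · exact h.rotate.rotate.ne_zero _ h0

/-- A local vector is orthogonal to at most one other. -/
lemma eq_of_orth (h : LocalUPB A B C) {i j k : Fin 4} (hj : inner2 (A i) (A j) = 0)
    (hk : inner2 (A i) (A k) = 0) : j = k :=
  h.eq_of_parallel (inner2_perp_eq_zero_of_common (h.ne_zero i) hj hk)

/-- Every member is orthogonal to some other one on the first party. -/
lemma exists_orth (h : LocalUPB A B C) (i : Fin 4) : ∃ j, i ≠ j ∧ inner2 (A i) (A j) = 0 := by
  obtain ⟨j, k, l, hij, hik, hil, hjk, hjl, hkl⟩ : ∃ j k l : Fin 4,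
      i ≠ j ∧ i ≠ k ∧ i ≠ l ∧ j ≠ k ∧ j ≠ l ∧ k ≠ l := by
    revert i; decide
  by_contra! hno
  have oj := (h.orth i j hij).resolve_left (hno j hij)
  have ok := (h.orth i k hik).resolve_left (hno k hik)
  have ol := (h.orth i l hil).resolve_left (hno l hil)
  have hB := fun p q => h.rotate.eq_of_orth (i := i) (j := p) (k := q)
  have hC := fun p q => h.rotate.rotate.eq_of_orth (i := i) (j := p) (k := q)
  grind

/-- In an expansion of a product vector along the basis, the nonzero coefficients belong to
members parallel to it on the first party. -/
lemma coeff_mul_eq_zero (h : LocalUPB A B C) {a b c : V2} {z : Fin 4 → ℂ}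
    (hz : ∀ x y w, inner2 x a * inner2 y b * inner2 w c =
      ∑ k, z k * (inner2 x (A k) * inner2 y (B k) * inner2 w (C k))) (i : Fin 4) :
    z i * inner2 (perp a) (A i) = 0 := by
  obtain ⟨j, hij, hAij⟩ := h.exists_orth i
  have key : ∀ p q, (p = i ∧ q = j ∨ p = j ∧ q = i) →
      z p * inner2 (perp a) (A p) + z q * inner2 (perp a) (A q) *
        (inner2 (B p) (B q) * inner2 (C p) (C q)) = 0 := by
    intro p q hpq
    have hpq' : p ≠ q := by rcases hpq with ⟨rfl, rfl⟩ | ⟨rfl, rfl⟩ <;> tauto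
    have hA : inner2 (A p) (A q) = 0 := by
      rcases hpq with ⟨rfl, rfl⟩ | ⟨rfl, rfl⟩
      exacts [hAij, inner2_comm_eq_zero hAij]
    have e := hz (perp a) (B p) (C p)
    rw [inner2_comm_eq_zero (inner2_perp_self a), zero_mul, zero_mul] at e
    rw [← Finset.sum_subset (Finset.subset_univ {p, q}), Finset.sum_pair hpq', h.normB,
      h.normC] at e
    · linear_combination -e
    · intro r _ hr
      simp only [Finset.mem_insert, Finset.mem_singleton, not_or] at hr
      rcases h.orth p r (Ne.symm hr.1) with o | o | o
      · exact absurd (h.eq_of_orth o hA) hr.2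
      · simp [o]
      · simp [o]
  have e1 := key i j (Or.inl ⟨rfl, rfl⟩)
  have e2 := key j i (Or.inr ⟨rfl, rfl⟩)
  have hB := inner2_lagrange (B i) (B j)
  have hC := inner2_lagrange (C i) (C j)
  have nB : inner2 (perp (B i)) (B j) ≠ 0 := fun h0 => hij (h.rotate.eq_of_parallel h0)
  simp only [h.normB, h.normC, mul_one] at hB hC
  set β := inner2 (B i) (B j) with hβ
  set γ := inner2 (C i) (C j) with hγ
  have sβ : inner2 (B j) (B i) = star β := (star_inner2 _ _).symm
  have sγ : inner2 (C j) (C i) = star γ := (star_inner2 _ _).symm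
  rw [sβ] at hB
  rw [sγ] at hC
  rw [sβ, sγ] at e2
  have e3 : (1 - β * star β * (γ * star γ)) * (z i * inner2 (perp a) (A i)) = 0 := by
    linear_combination e1 - β * γ * e2
  refine (mul_eq_zero.1 e3).resolve_left fun h0 => ?_
  simp only [RCLike.star_def, Complex.mul_conj] at hB hC h0
  norm_cast at hB hC h0
  have pB := Complex.normSq_pos.2 nB
  have nC := Complex.normSq_nonneg (inner2 (perp (C i)) (C j))
  nlinarith [Complex.normSq_nonneg β, Complex.normSq_nonneg γ]

/-- The only product vectors in the span of the basis are multiples of its members. -/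
lemma exists_parallel (h : LocalUPB A B C) {a b c : V2} {z : Fin 4 → ℂ}
    (ha : a ≠ 0) (hb : b ≠ 0) (hc : c ≠ 0)
    (hz : ∀ x y w, inner2 x a * inner2 y b * inner2 w c =
      ∑ k, z k * (inner2 x (A k) * inner2 y (B k) * inner2 w (C k))) :
    ∃ k, inner2 (perp a) (A k) = 0 ∧ inner2 (perp b) (B k) = 0 ∧ inner2 (perp c) (C k) = 0 := by
  obtain ⟨k, hk⟩ : ∃ k, z k ≠ 0 := by
    by_contra! h0
    have := hz a b c
    simp only [h0, zero_mul, Finset.sum_const_zero, mul_eq_zero, inner2_self_eq_zero] at this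
    tauto
  have hB := h.rotate.coeff_mul_eq_zero (a := b) (b := c) (c := a) (z := z)
    (fun x y w => by
      rw [← mul_rotate, hz]
      exact Finset.sum_congr rfl fun k _ => by ring) k
  have hC := h.rotate.rotate.coeff_mul_eq_zero (a := c) (b := a) (c := b) (z := z)
    (fun x y w => by
      rw [mul_rotate, hz]
      exact Finset.sum_congr rfl fun k _ => by ring) k
  exact ⟨k, (mul_eq_zero.1 (h.coeff_mul_eq_zero hz k)).resolve_left hk,
    (mul_eq_zero.1 hB).resolve_left hk, (mul_eq_zero.1 hC).resolve_left hk⟩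

end LocalUPB

/-! ### Three-qubit operators -/

lemma kron3_eq_kronecker (X Y Z : M2) :
    kron3 X Y Z = Matrix.kronecker X (Matrix.kronecker Y Z) := by
  ext p q
  simp [kron3, mul_assoc]

lemma kron3_mul (X Y Z X' Y' Z' : M2) :
    kron3 X Y Z * kron3 X' Y' Z' = kron3 (X * X') (Y * Y') (Z * Z') := by
  simp only [kron3_eq_kronecker, Matrix.kronecker, ← Matrix.mul_kronecker_mul]

lemma kron3_conjTranspose (X Y Z : M2) : (kron3 X Y Z)ᴴ = kron3 Xᴴ Yᴴ Zᴴ := by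
  ext p q
  simp [kron3]

lemma kron3_smul (x y z : ℂ) (X Y Z : M2) :
    kron3 (x • X) (y • Y) (z • Z) = (x * y * z) • kron3 X Y Z := by
  ext p q
  simp [kron3]; ring

lemma kron3_mulVec_tp3 (X Y Z : M2) (a b c : V2) :
    kron3 X Y Z *ᵥ tp3 a b c = tp3 (X *ᵥ a) (Y *ᵥ b) (Z *ᵥ c) := by
  ext p
  simp [kron3, tp3, Matrix.mulVec, dotProduct, Fintype.sum_prod_type, Fin.sum_univ_two]
  ring

lemma inner8_eq_dotProduct (u v : V8) : inner8 u v = star u ⬝ᵥ v := by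
  simp [inner8, dotProduct]

lemma proj8_mulVec (u v : V8) : proj8 u *ᵥ v = inner8 u v • u := by
  rw [proj8, Matrix.vecMulVec_mulVec, inner8_eq_dotProduct]
  ext; simp [mul_comm]

lemma tp3_eq_zero {a b c : V2} (h : tp3 a b c = 0) : a = 0 ∨ b = 0 ∨ c = 0 := by
  have h0 := inner8_tp3 a b c a b c
  rw [h] at h0
  have : inner8 0 0 = 0 := by simp [inner8]
  rw [this] at h0
  simpa [inner2_self_eq_zero, or_assoc] using h0.symm

lemma mul_proj8_mul_conjTranspose (X : M8) (v : V8) :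
    X * proj8 v * Xᴴ = proj8 (X *ᵥ v) := by
  rw [proj8, proj8, Matrix.mul_vecMulVec, Matrix.vecMulVec_mul, Matrix.star_mulVec]

/-! ### The projector onto the complement of an unextendible product basis -/

namespace UPB

/-- the projector onto the orthogonal complement of the basis -/
def compl (U : UPB 4) : M8 := 1 - ∑ j, proj8 (U.S j)

lemma upbState_eq (U : UPB 4) : upbState U = (4 : ℂ)⁻¹ • U.compl := by
  rw [upbState, compl]
  norm_num

lemma compl_mulVec (U : UPB 4) (v : V8) :
    U.compl *ᵥ v = v - ∑ j, inner8 (U.S j) v • U.S j := by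
  simp [compl, Matrix.sub_mulVec, Matrix.sum_mulVec, proj8_mulVec]

lemma compl_isHermitian (U : UPB 4) : U.complᴴ = U.compl := by
  simp [compl, proj8, Matrix.conjTranspose_sum, Matrix.conjTranspose_vecMulVec]

lemma compl_mulVec_self (U : UPB 4) (i : Fin 4) : U.compl *ᵥ U.S i = 0 := by
  simp [compl_mulVec, U.ortho]

lemma compl_mul_self (U : UPB 4) : U.compl * U.compl = U.compl := by
  have h : ∀ i, U.compl * proj8 (U.S i) = 0 := fun i => by
    rw [proj8, Matrix.mul_vecMulVec, compl_mulVec_self, Matrix.zero_vecMulVec]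
  nth_rewrite 2 [compl]
  rw [mul_sub, mul_one, Finset.mul_sum, Finset.sum_eq_zero fun i _ => h i, sub_zero]

/-- `X P X†` is a Gram matrix. -/
lemma conj_compl_eq (U : UPB 4) (X : M8) : X * U.compl * Xᴴ = X * U.compl * (X * U.compl)ᴴ := by
  rw [Matrix.conjTranspose_mul, compl_isHermitian]
  nth_rewrite 1 [← compl_mul_self]
  simp only [Matrix.mul_assoc]

lemma conj_compl_posSemidef (U : UPB 4) (X : M8) : (X * U.compl * Xᴴ).PosSemidef := by
  rw [conj_compl_eq]
  exact Matrix.posSemidef_self_mul_conjTranspose _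

/-- `⟨v|P|v⟩ = 0` only when `P v = 0`. -/
lemma compl_mulVec_eq_zero (U : UPB 4) {v : V8} (h : inner8 v (U.compl *ᵥ v) = 0) :
    U.compl *ᵥ v = 0 := by
  rw [inner8_eq_dotProduct, ← compl_mul_self, ← Matrix.mulVec_mulVec, Matrix.dotProduct_mulVec] at h
  nth_rewrite 1 [← compl_isHermitian] at h
  rw [← Matrix.star_mulVec] at h
  exact dotProduct_star_self_eq_zero.1 h

/-- local vectors of the members of a basis -/
lemma exists_local (U : UPB 4) :
    ∃ A B C : Fin 4 → V2, LocalUPB A B C ∧ ∀ j, U.S j = tp3 (A j) (B j) (C j) := by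
  choose A B C hA hB hC hS using U.prod
  refine ⟨A, B, C, ⟨hA, hB, hC, fun i j hij => ?_, fun a b c h => ?_⟩, hS⟩
  · have := U.ortho i j
    rw [if_neg hij, hS, hS, inner8_tp3] at this
    simpa [or_assoc] using this
  · refine tp3_eq_zero (U.unext a b c fun j => ?_)
    rw [hS, inner8_tp3]
    have := h j
    simp only [mul_eq_zero]
    tauto

/-- A product vector in the span of the basis is parallel to one of the members. -/
lemma exists_parallel (U : UPB 4) {A B C : Fin 4 → V2} (h : LocalUPB A B C)
    (hS : ∀ j, U.S j = tp3 (A j) (B j) (C j)) {a b c : V2} (ha : a ≠ 0) (hb : b ≠ 0) (hc : c ≠ 0)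
    (hv : U.compl *ᵥ tp3 a b c = 0) :
    ∃ k, inner2 (perp a) (A k) = 0 ∧ inner2 (perp b) (B k) = 0 ∧ inner2 (perp c) (C k) = 0 := by
  refine h.exists_parallel ha hb hc (z := fun j => inner8 (U.S j) (tp3 a b c)) fun x y w => ?_
  rw [compl_mulVec, sub_eq_zero] at hv
  rw [← inner8_tp3]
  nth_rewrite 1 [hv]
  simp only [inner8_eq_dotProduct, dotProduct_sum, dotProduct_smul, smul_eq_mul]
  refine Finset.sum_congr rfl fun k _ => ?_
  rw [← inner8_tp3, ← hS, inner8_eq_dotProduct (tp3 x y w)]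

/-- The local operators of a nonzero product operator annihilating the complement of the basis
all annihilate the vectors orthogonal to those of one member. -/
lemma exists_mulVec_perp_eq_zero (U : UPB 4) {A B C : Fin 4 → V2} (h : LocalUPB A B C)
    (hS : ∀ j, U.S j = tp3 (A j) (B j) (C j)) {X Y Z : M2} (hX : X ≠ 0) (hY : Y ≠ 0) (hZ : Z ≠ 0)
    (h0 : kron3 X Y Z * U.compl = 0) :
    ∃ k, X *ᵥ perp (A k) = 0 ∧ Y *ᵥ perp (B k) = 0 ∧ Z *ᵥ perp (C k) = 0 := by
  have hP : ∀ x y z, U.compl *ᵥ tp3 (Xᴴ *ᵥ x) (Yᴴ *ᵥ y) (Zᴴ *ᵥ z) = 0 := fun x y z => by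
    rw [← kron3_mulVec_tp3, ← kron3_conjTranspose, Matrix.mulVec_mulVec]
    nth_rewrite 1 [← compl_isHermitian]
    rw [← Matrix.conjTranspose_mul, h0, Matrix.conjTranspose_zero, Matrix.zero_mulVec]
  have hne : ∀ {M : M2}, M ≠ 0 → ∃ x, Mᴴ *ᵥ x ≠ 0 := fun {M} hM => by
    by_contra! hall
    refine hM (Matrix.conjTranspose_eq_zero.1 ?_)
    exact Matrix.ext_of_mulVec_single fun i => by rw [hall, Matrix.zero_mulVec]
  have fin : ∀ {M : M2} {u : V2}, (∀ x, Mᴴ *ᵥ x ≠ 0 → inner2 (perp (Mᴴ *ᵥ x)) u = 0) →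
      M *ᵥ perp u = 0 := fun {M u} hu => by
    rw [← inner2_self_eq_zero, inner2_mulVec]
    by_cases hx : Mᴴ *ᵥ (M *ᵥ perp u) = 0
    · rw [hx]; simp [inner2]
    · refine inner2_comm_eq_zero ?_
      rw [inner2_perp_swap, neg_eq_zero]
      exact hu _ hx
  obtain ⟨x, hx⟩ := hne hX
  obtain ⟨y, hy⟩ := hne hY
  obtain ⟨z, hz⟩ := hne hZ
  obtain ⟨k, kX, kY, kZ⟩ := U.exists_parallel h hS hx hy hz (hP x y z)
  have par : ∀ {u v w : V2}, u ≠ 0 → inner2 (perp u) v = 0 → inner2 (perp u) w = 0 →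
      inner2 (perp v) w = 0 := fun {u v w} hu =>
    inner2_perp_eq_zero_of_common (by rwa [Ne, perp_eq_zero])
  refine ⟨k, fin fun x' hx' => ?_, fin fun y' hy' => ?_, fin fun z' hz' => ?_⟩
  · obtain ⟨k', k1, k2, k3⟩ := U.exists_parallel h hS hx' hy hz (hP x' y z)
    rwa [h.rotate.eq_of_parallel (par hy kY k2)]
  · obtain ⟨k', k1, k2, k3⟩ := U.exists_parallel h hS hx hy' hz (hP x y' z)
    rwa [h.eq_of_parallel (par hx kX k1)]
  · obtain ⟨k', k1, k2, k3⟩ := U.exists_parallel h hS hx hy hz' (hP x y z')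
    rwa [h.eq_of_parallel (par hx kX k1)]

end UPB

/-! ### Sums of product projectors -/

/-- an unnormalized separable operator with at most four terms -/
def IsProductSum (M : M8) : Prop :=
  ∃ a b c : Fin 4 → V2, M = ∑ i, proj8 (tp3 (a i) (b i) (c i))

lemma IsProductSum.conj {M : M8} (h : IsProductSum M) (X Y Z : M2) :
    IsProductSum (kron3 X Y Z * M * (kron3 X Y Z)ᴴ) := by
  obtain ⟨a, b, c, rfl⟩ := h
  refine ⟨fun i => X *ᵥ a i, fun i => Y *ᵥ b i, fun i => Z *ᵥ c i, ?_⟩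
  simp only [Finset.mul_sum, Finset.sum_mul, mul_proj8_mul_conjTranspose, kron3_mulVec_tp3]

lemma proj8_tp3_smul (x y z : ℝ) (a b c : V2) :
    proj8 (tp3 ((x : ℂ) • a) ((y : ℂ) • b) ((z : ℂ) • c)) =
      ((x ^ 2 * y ^ 2 * z ^ 2 : ℝ) : ℂ) • proj8 (tp3 a b c) := by
  ext p q
  simp [proj8, tp3, Matrix.vecMulVec_apply]
  ring

lemma IsProductSum.smul {M : M8} (h : IsProductSum M) {r : ℝ} (hr : 0 ≤ r) :
    IsProductSum ((r : ℂ) • M) := by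
  obtain ⟨a, b, c, rfl⟩ := h
  refine ⟨fun i => ((√r : ℝ) : ℂ) • a i, b, c, ?_⟩
  rw [Finset.smul_sum]
  refine Finset.sum_congr rfl fun i _ => ?_
  have := proj8_tp3_smul (√r) 1 1 (a i) (b i) (c i)
  simpa [Real.sq_sqrt hr] using this.symm

lemma exists_eq_smul_unit (u : V2) :
    ∃ (x : ℝ) (v : V2), inner2 v v = 1 ∧ u = (x : ℂ) • v := by
  by_cases hu : u = 0
  · exact ⟨0, ![1, 0], by simp [inner2], by simp [hu]⟩
  · set r := Complex.normSq (u 0) + Complex.normSq (u 1) with hr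
    have hr0 : 0 ≤ r := add_nonneg (Complex.normSq_nonneg _) (Complex.normSq_nonneg _)
    have hrne : r ≠ 0 := fun h0 => hu <| inner2_self_eq_zero.1 <| by
      rw [inner2_self_eq, ← hr, h0, Complex.ofReal_zero]
    have hs : √r ≠ 0 := (Real.sqrt_ne_zero hr0).2 hrne
    refine ⟨√r, ((√r)⁻¹ : ℝ) • u, ?_, ?_⟩
    · rw [inner2_self_eq]
      simp only [Pi.smul_apply, Complex.real_smul, Complex.normSq_mul, Complex.normSq_ofReal]
      rw [← mul_add, ← hr, ← mul_inv, Real.mul_self_sqrt hr0, inv_mul_cancel₀ hrne,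
        Complex.ofReal_one]
    · ext i
      simp [hs]

lemma trace_proj8 (v : V8) : (proj8 v).trace = inner8 v v := by
  simp [proj8, inner8, Matrix.trace, Matrix.vecMulVec_apply, mul_comm]

lemma IsProductSum.isSeparable8 {M : M8} (h : IsProductSum M) (htr : M.trace = 1) :
    IsSeparable8 M := by
  obtain ⟨a, b, c, rfl⟩ := h
  choose x a' ha ha' using fun i => exists_eq_smul_unit (a i)
  choose y b' hb hb' using fun i => exists_eq_smul_unit (b i)
  choose z c' hc hc' using fun i => exists_eq_smul_unit (c i)
  have e : ∑ i, proj8 (tp3 (a i) (b i) (c i)) =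
      ∑ i, ((x i ^ 2 * y i ^ 2 * z i ^ 2 : ℝ) : ℂ) • proj8 (tp3 (a' i) (b' i) (c' i)) :=
    Finset.sum_congr rfl fun i _ => by rw [ha', hb', hc', proj8_tp3_smul]
  refine ⟨4, fun i => x i ^ 2 * y i ^ 2 * z i ^ 2, a', b', c', fun i => by positivity, ?_,
    fun i => ⟨ha i, hb i, hc i⟩, e⟩
  rw [e, Matrix.trace_sum] at htr
  simp only [Matrix.trace_smul, trace_proj8, inner8_tp3, ha, hb, hc, mul_one, smul_eq_mul] at htr
  exact_mod_cast htr

/-- the number of excitations of a computational basis label -/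
def weight (I : I8) : ℕ := I.1.val + I.2.1.val + I.2.2.val

/-- A positive semidefinite matrix supported on the span of `|000⟩, |100⟩, |010⟩, |001⟩`, without
coherences among the last three vectors, is a sum of product projectors. -/
lemma Matrix.PosSemidef.isProductSum {M : M8} (hM : M.PosSemidef)
    (hh : ∀ I J, 2 ≤ weight I → M I J = 0)
    (hxy : M (1, 0, 0) (0, 1, 0) = 0) (hxz : M (1, 0, 0) (0, 0, 1) = 0)
    (hyz : M (0, 1, 0) (0, 0, 1) = 0) : IsProductSum M := by
  have hs : ∀ I J, M I J = star (M J I) := fun I J => (hM.1.apply I J).symm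
  have hh' : ∀ I J, 2 ≤ weight J → M I J = 0 := fun I J hJ => by rw [hs, hh _ _ hJ, star_zero]
  have hyx : M (0, 1, 0) (1, 0, 0) = 0 := by rw [hs, hxy, star_zero]
  have hzx : M (0, 0, 1) (1, 0, 0) = 0 := by rw [hs, hxz, star_zero]
  have hzy : M (0, 0, 1) (0, 1, 0) = 0 := by rw [hs, hyz, star_zero]
  have hd : ∀ I, ∃ q : ℝ, 0 ≤ q ∧ M I I = q := fun I => by
    have := hM.diag_nonneg (i := I)
    rw [Complex.nonneg_iff] at this
    exact ⟨(M I I).re, this.1, Complex.ext rfl (by simpa using this.2.symm)⟩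
  have hz : ∀ I J, M J J = 0 → M I J = 0 := fun I J hJ => by
    have := (hM.dotProduct_mulVec_zero_iff (Pi.single J 1)).1 (by simp [hJ])
    simpa using congrFun this I
  obtain ⟨e, he, heM⟩ := hd (0, 0, 0)
  obtain ⟨p, hp, hpM⟩ := hd (1, 0, 0)
  obtain ⟨q, hq, hqM⟩ := hd (0, 1, 0)
  obtain ⟨r, hr, hrM⟩ := hd (0, 0, 1)
  obtain ⟨x, ex⟩ : ∃ x, M (0, 0, 0) (1, 0, 0) = x := ⟨_, rfl⟩
  obtain ⟨y, ey⟩ : ∃ y, M (0, 0, 0) (0, 1, 0) = y := ⟨_, rfl⟩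
  obtain ⟨z, ez⟩ : ∃ z, M (0, 0, 0) (0, 0, 1) = z := ⟨_, rfl⟩
  have hx0 : p = 0 → x = 0 := fun h => ex ▸ hz _ _ (by rw [hpM, h]; rfl)
  have hy0 : q = 0 → y = 0 := fun h => ey ▸ hz _ _ (by rw [hqM, h]; rfl)
  have hz0 : r = 0 → z = 0 := fun h => ez ▸ hz _ _ (by rw [hrM, h]; rfl)
  have ex' : M (1, 0, 0) (0, 0, 0) = star x := by rw [hs, ex]
  have ey' : M (0, 1, 0) (0, 0, 0) = star y := by rw [hs, ey]
  have ez' : M (0, 0, 1) (0, 0, 0) = star z := by rw [hs, ez]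
  set f := e - Complex.normSq x / p - Complex.normSq y / q - Complex.normSq z / r with hf
  have cancel : ∀ {w : ℂ} {s : ℝ}, (s = 0 → w = 0) → w / s * s = w := fun {w s} h => by
    by_cases h0 : s = 0
    · simp [h h0]
    · field_simp
  have hf0 : 0 ≤ f := by
    have := hM.dotProduct_mulVec_nonneg
      (Pi.single (0, 0, 0) 1 - Pi.single (1, 0, 0) (star x / p) - Pi.single (0, 1, 0) (star y / q)
        - Pi.single (0, 0, 1) (star z / r))
    have e1 : x / p * p = x := cancel hx0
    have e2 : y / q * q = y := cancel hy0
    have e3 : z / r * r = z := cancel hz0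
    have e4 : (f : ℂ) = e - x * star x / p - y * star y / q - z * star z / r := by
      simp [hf, Complex.mul_conj]
    suffices h : (f : ℂ) ≥ 0 by exact_mod_cast h
    rw [e4]
    convert this using 1
    simp [Matrix.mulVec_sub, sub_dotProduct, dotProduct_sub, hxy, hxz, hyz, hyx, hzx, hzy, heM,
      hpM, hqM, hrM, ex, ey, ez, ex', ey', ez', e1, e2, e3]
    ring
  have ss : ∀ {s : ℝ}, 0 ≤ s → ((√s : ℝ) : ℂ) * ((√s : ℝ) : ℂ) = s := fun {s} h => by
    rw [← Complex.ofReal_mul, Real.mul_self_sqrt h]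
  have hsq : ∀ {w : ℂ} {s : ℝ}, 0 ≤ s → (s = 0 → w = 0) →
      w / ((√s : ℝ) : ℂ) * ((√s : ℝ) : ℂ) = w ∧
      ((√s : ℝ) : ℂ) * (starRingEnd ℂ w / ((√s : ℝ) : ℂ)) = starRingEnd ℂ w := fun {w s} h h' =>
    ⟨cancel fun h0 => h' ((Real.sqrt_eq_zero h).1 h0), by
      rw [mul_comm]
      exact cancel fun h0 => by rw [h' ((Real.sqrt_eq_zero h).1 h0), map_zero]⟩
  have hno : ∀ {w : ℂ} {s : ℝ}, 0 ≤ s → w / ((√s : ℝ) : ℂ) *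
      (starRingEnd ℂ w / ((√s : ℝ) : ℂ)) = Complex.normSq w / s := fun {w s} h => by
    rw [div_mul_div_comm, ss h, Complex.mul_conj]
  refine ⟨![![(√f : ℝ), 0], ![x / (√p : ℝ), (√p : ℝ)], ![1, 0], ![1, 0]],
    ![![1, 0], ![1, 0], ![y / (√q : ℝ), (√q : ℝ)], ![1, 0]],
    ![![1, 0], ![1, 0], ![1, 0], ![z / (√r : ℝ), (√r : ℝ)]], ?_⟩
  ext ⟨i, j, k⟩ ⟨i', j', k'⟩
  simp only [Fin.sum_univ_four, Matrix.add_apply, proj8, Matrix.vecMulVec_apply, tp3,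
    Pi.star_apply]
  fin_cases i <;> fin_cases j <;> fin_cases k <;> fin_cases i' <;> fin_cases j' <;> fin_cases k' <;>
    simp [hh, hh', weight, hxy, hxz, hyz, hyx, hzx, hzy, heM, hpM, hqM, hrM, ex, ey, ez, ex', ey',
      ez', ss, hf0, hp, hq, hr, hsq hp hx0, hsq hq hy0, hsq hr hz0, hno]
  rw [hf]
  push_cast
  ring

/-! ### Limits -/

open Filter Topology Asymptotics in
/-- Limits of rescaled local contractions towards `|000⟩` of matrices annihilating `|000⟩`
asymptotically. -/
lemma tendsto_contraction_entries {P Z : ℕ → M8} {Q W : M8} {a b c : ℕ → ℂ} {s : ℕ → ℝ}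
    (hP : Tendsto P atTop (𝓝 Q)) (hZ : Tendsto Z atTop (𝓝 W))
    (hb : Tendsto b atTop (𝓝 0)) (hc : Tendsto c atTop (𝓝 0))
    (hZP : ∀ n, Z n = ((s n : ℂ) ^ 2)⁻¹ •
      (kron3 (diagonal ![1, a n]) (diagonal ![1, b n]) (diagonal ![1, c n]) * P n *
        (kron3 (diagonal ![1, a n]) (diagonal ![1, b n]) (diagonal ![1, c n]))ᴴ))
    (hQ : ∀ I, Q I (0, 0, 0) = 0)
    (hx : Q (1, 0, 0) (1, 0, 0) ≠ 0) (hy : Q (0, 1, 0) (0, 1, 0) ≠ 0)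
    (hz : Q (0, 0, 1) (0, 0, 1) ≠ 0)
    (hxy : Q (1, 0, 0) (0, 1, 0) = 0) (hxz : Q (1, 0, 0) (0, 0, 1) = 0)
    (hyz : Q (0, 1, 0) (0, 0, 1) = 0) :
    (∀ I J, 2 ≤ weight I → W I J = 0) ∧ W (1, 0, 0) (0, 1, 0) = 0 ∧
      W (1, 0, 0) (0, 0, 1) = 0 ∧ W (0, 1, 0) (0, 0, 1) = 0 := by
  let d : ℕ → I8 → ℂ := fun n I => ![1, a n] I.1 * ![1, b n] I.2.1 * ![1, c n] I.2.2
  have hD : ∀ n, kron3 (diagonal ![1, a n]) (diagonal ![1, b n]) (diagonal ![1, c n]) =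
      diagonal (d n) := fun n => by
    ext ⟨i, j, k⟩ ⟨i', j', k'⟩
    fin_cases i <;> fin_cases j <;> fin_cases k <;> fin_cases i' <;> fin_cases j' <;>
      fin_cases k' <;> simp [kron3, d]
  have entry : ∀ n I J, Z n I J = d n I / s n * P n I J * star (d n J / s n) := fun n I J => by
    rw [hZP, hD, Matrix.diagonal_conjTranspose]
    simp [Matrix.mul_diagonal, Matrix.diagonal_mul]
    ring
  have hPe : ∀ I J, Tendsto (fun n => P n I J) atTop (𝓝 (Q I J)) := fun I J =>
    tendsto_pi_nhds.1 (tendsto_pi_nhds.1 hP I) J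
  have hZe : ∀ I J, Tendsto (fun n => Z n I J) atTop (𝓝 (W I J)) := fun I J =>
    tendsto_pi_nhds.1 (tendsto_pi_nhds.1 hZ I) J
  have bdd : ∀ I, Q I I ≠ 0 → (fun n => d n I / s n) =O[atTop] (fun _ => (1 : ℝ)) := by
    intro I hI
    have h1 : (fun n => Z n I I / P n I I) =O[atTop] (fun _ => (1 : ℝ)) :=
      ((hZe I I).div (hPe I I) hI).isBigO_one ℝ
    have h2 : ((fun n => ‖d n I / s n‖) ^ 2) =O[atTop] ((fun _ => (1 : ℝ)) ^ 2) := by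
      have h3 : ((fun _ => (1 : ℝ)) ^ 2 : ℕ → ℝ) = fun _ => 1 := by ext; simp
      rw [h3]
      refine IsBigO.trans (EventuallyEq.isBigO ?_) h1.norm_left
      filter_upwards [(hPe I I).eventually_ne hI] with n hn
      rw [entry, mul_right_comm, mul_div_assoc, div_self hn, mul_one, norm_mul, norm_star,
        Pi.pow_apply, sq]
    exact (IsBigO.of_pow two_ne_zero h2).of_norm_left
  have hα : (fun n => a n / s n) =O[atTop] (fun _ => (1 : ℝ)) := by
    simpa [d] using bdd (1, 0, 0) hx
  have hβ : (fun n => b n / s n) =O[atTop] (fun _ => (1 : ℝ)) := by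
    simpa [d] using bdd (0, 1, 0) hy
  have hγ : (fun n => c n / s n) =O[atTop] (fun _ => (1 : ℝ)) := by
    simpa [d] using bdd (0, 0, 1) hz
  have hb' : b =o[atTop] (fun _ => (1 : ℝ)) := (isLittleO_one_iff ℝ).2 hb
  have hc' : c =o[atTop] (fun _ => (1 : ℝ)) := (isLittleO_one_iff ℝ).2 hc
  have mul_O : ∀ {f g h : ℕ → ℂ}, f =O[atTop] (fun _ => (1 : ℝ)) → g =O[atTop] (fun _ => (1 : ℝ)) →
      (∀ n, f n * g n = h n) → h =O[atTop] (fun _ => (1 : ℝ)) := fun hf hg e =>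
    (hf.mul hg).congr e fun _ => mul_one 1
  have mul_o : ∀ {f g h : ℕ → ℂ}, f =O[atTop] (fun _ => (1 : ℝ)) → g =o[atTop] (fun _ => (1 : ℝ)) →
      (∀ n, f n * g n = h n) → h =o[atTop] (fun _ => (1 : ℝ)) := fun hf hg e =>
    (hf.mul_isLittleO hg).congr e fun _ => mul_one 1
  have small : ∀ I, 2 ≤ weight I →
      (fun n => d n I / s n) =o[atTop] (fun _ => (1 : ℝ)) ∧
      (fun n => d n I / s n / s n) =O[atTop] (fun _ => (1 : ℝ)) := by
    rintro ⟨i, j, k⟩ hI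
    have hαβ := mul_O hα hβ fun _ => rfl
    have hαb := mul_o hα hb' fun _ => rfl
    fin_cases i <;> fin_cases j <;> fin_cases k <;> simp [weight] at hI
    · exact ⟨mul_o hβ hc' fun n => by simp [d]; ring, mul_O hβ hγ fun n => by simp [d]; ring⟩
    · exact ⟨mul_o hα hc' fun n => by simp [d]; ring, mul_O hα hγ fun n => by simp [d]; ring⟩
    · exact ⟨mul_o hα hb' fun n => by simp [d]; ring, mul_O hα hβ fun n => by simp [d]; ring⟩
    · exact ⟨mul_o hαb.isBigO hc' fun n => by simp [d]; ring,
        mul_O hαβ hc'.isBigO fun n => by simp [d]; ring⟩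
  have large : ∀ I, I ≠ (0, 0, 0) → (fun n => d n I / s n) =O[atTop] (fun _ => (1 : ℝ)) := by
    intro I hI
    by_cases hw : 2 ≤ weight I
    · exact (small I hw).1.isBigO
    · obtain ⟨i, j, k⟩ := I
      fin_cases i <;> fin_cases j <;> fin_cases k <;> simp [weight] at hw hI
      · exact hγ.congr_left fun n => by simp [d]
      · exact hβ.congr_left fun n => by simp [d]
      · exact hα.congr_left fun n => by simp [d]
  have zero : ∀ I J, (fun n => Z n I J) =o[atTop] (fun _ => (1 : ℝ)) → W I J = 0 := fun I J h =>
    tendsto_nhds_unique (hZe I J) ((isLittleO_one_iff ℝ).1 h)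
  have star_O : ∀ {f : ℕ → ℂ}, f =O[atTop] (fun _ => (1 : ℝ)) →
      (fun n => star (f n)) =O[atTop] (fun _ => (1 : ℝ)) := fun {f} h =>
    IsBigO.of_norm_left (by simpa only [norm_star] using h.norm_left)
  have off : ∀ I J, I ≠ (0, 0, 0) → J ≠ (0, 0, 0) → Q I J = 0 → W I J = 0 := fun I J hI hJ h => by
    refine zero I J ?_
    simp only [entry]
    have hq : (fun n => P n I J) =o[atTop] (fun _ => (1 : ℝ)) :=
      (isLittleO_one_iff ℝ).2 (h ▸ hPe I J)
    exact mul_o (star_O (large J hJ)) (mul_o (large I hI) hq fun _ => rfl) fun _ => mul_comm _ _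
  refine ⟨fun I J hI => zero I J ?_, off _ _ (by decide) (by decide) hxy,
    off _ _ (by decide) (by decide) hxz, off _ _ (by decide) (by decide) hyz⟩
  simp only [entry]
  by_cases hJ : J = (0, 0, 0)
  · subst hJ
    have hq : (fun n => P n I (0, 0, 0)) =o[atTop] (fun _ => (1 : ℝ)) :=
      (isLittleO_one_iff ℝ).2 (hQ I ▸ hPe I _)
    exact mul_o (small I hI).2 hq fun n => by simp [d]; ring
  · exact mul_o (mul_O ((hPe I J).isBigO_one ℝ) (star_O (large J hJ)) fun _ => rfl) (small I hI).1
      fun n => by ring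

lemma isClosed_setOf_posSemidef : IsClosed {M : M8 | M.PosSemidef} := by
  simp only [Matrix.posSemidef_iff_dotProduct_mulVec, Set.ofPred_and, Set.ofPred_forall]
  refine (isClosed_eq continuous_id.matrix_conjTranspose continuous_id).inter
    (isClosed_iInter fun x => ?_)
  exact isClosed_le continuous_const
    (continuous_const.dotProduct (continuous_id.matrix_mulVec continuous_const))

lemma tendsto_kron3 {X Y Z : ℕ → M2} {X' Y' Z' : M2} (hX : Filter.Tendsto X Filter.atTop (nhds X'))
    (hY : Filter.Tendsto Y Filter.atTop (nhds Y')) (hZ : Filter.Tendsto Z Filter.atTop (nhds Z')) :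
    Filter.Tendsto (fun n => kron3 (X n) (Y n) (Z n)) Filter.atTop (nhds (kron3 X' Y' Z')) := by
  have entry : ∀ {M : ℕ → M2} {M' : M2}, Filter.Tendsto M Filter.atTop (nhds M') → ∀ i j,
      Filter.Tendsto (fun n => M n i j) Filter.atTop (nhds (M' i j)) := fun h i j =>
    tendsto_pi_nhds.1 (tendsto_pi_nhds.1 h i) j
  exact tendsto_pi_nhds.2 fun p => tendsto_pi_nhds.2 fun q =>
    ((entry hX p.1 q.1).mul (entry hY p.2.1 q.2.1)).mul (entry hZ p.2.2 q.2.2)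

/-! ### Degenerate limits of local filterings -/

/-- the matrix with columns `u` and `perp u` -/
def frame (u : V2) : M2 := !![u 0, perp u 0; u 1, perp u 1]

lemma frame_mul_conjTranspose (u : V2) : frame u * (frame u)ᴴ = inner2 u u • 1 := by
  ext i j
  fin_cases i <;> fin_cases j <;>
    simp [frame, perp, inner2, Matrix.mul_apply, Fin.sum_univ_two] <;> ring

lemma frame_apply (u : V2) (i j : Fin 2) : frame u i j = ![u, perp u] j i := by
  fin_cases i <;> fin_cases j <;> simp [frame]

lemma conjTranspose_frame_mul (M : M2) (α : V2) :
    (frame (M *ᵥ α))ᴴ * M * frame α =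
      diagonal ![1, inner2 (perp (M *ᵥ α)) (M *ᵥ perp α)] *
        !![inner2 (M *ᵥ α) (M *ᵥ α), inner2 (M *ᵥ α) (M *ᵥ perp α); 0, 1] := by
  ext i j
  fin_cases i <;> fin_cases j <;>
    simp [frame, perp, inner2, Matrix.mul_apply, Fin.sum_univ_two, Matrix.mulVec, dotProduct] <;>
    ring

lemma continuous_frame : Continuous frame := by
  refine continuous_matrix fun i j => ?_
  fin_cases i <;> fin_cases j <;> simp [frame, perp] <;> fun_prop

open Filter Topology in
lemma tendsto_inner2 {u v : ℕ → V2} {u' v' : V2} (hu : Tendsto u atTop (𝓝 u'))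
    (hv : Tendsto v atTop (𝓝 v')) :
    Tendsto (fun n => inner2 (u n) (v n)) atTop (𝓝 (inner2 u' v')) := by
  unfold inner2
  exact tendsto_finsetSum _ fun i _ =>
    ((tendsto_pi_nhds.1 hu i).star).mul (tendsto_pi_nhds.1 hv i)

lemma continuous_perp : Continuous perp := by
  refine continuous_pi fun i => ?_
  fin_cases i <;> simp [perp] <;> fun_prop

/-- A nonzero operator annihilating `perp α` does not annihilate `α`. -/
lemma mulVec_ne_zero_of_perp {X : M2} (h0 : X ≠ 0) {α : V2} (hα : inner2 α α = 1)
    (hα' : X *ᵥ perp α = 0) : X *ᵥ α ≠ 0 := fun hu => by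
  have h1 : X * frame α = 0 := by
    ext i j
    have e0 := congrFun hu i
    have e1 := congrFun hα' i
    fin_cases j
    · simpa [frame, Matrix.mul_apply, Matrix.mulVec, dotProduct, Fin.sum_univ_two] using e0
    · simpa [frame, Matrix.mul_apply, Matrix.mulVec, dotProduct, Fin.sum_univ_two] using e1
  have h2 := frame_mul_conjTranspose α
  rw [hα, one_smul] at h2
  refine h0 ?_
  rw [← mul_one X, ← h2, ← Matrix.mul_assoc, h1, Matrix.zero_mul]

open Filter Topology in
/-- In adapted frames, a convergent sequence of operators whose limit annihilates `perp α` is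
triangular up to a contraction. -/
lemma exists_frames {X : ℕ → M2} {X' : M2} (hX : Tendsto X atTop (𝓝 X')) (h0 : X' ≠ 0) {α : V2}
    (hα : inner2 α α = 1) (hα' : X' *ᵥ perp α = 0) :
    ∃ (F V : ℕ → M2) (a : ℕ → ℂ) (F' : M2) (r : ℝ), 0 < r ∧ Tendsto F atTop (𝓝 F') ∧
      Tendsto V atTop (𝓝 (diagonal ![(r : ℂ), 1])) ∧ Tendsto a atTop (𝓝 0) ∧
      (∀ n, (F n)ᴴ * X n * frame α = diagonal ![1, a n] * V n) ∧
      F' * F'ᴴ = (r : ℂ) • 1 := by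
  have hu := mulVec_ne_zero_of_perp h0 hα hα'
  obtain ⟨r, hr, hrpos⟩ : ∃ r : ℝ, inner2 (X' *ᵥ α) (X' *ᵥ α) = r ∧ 0 < r := by
    refine ⟨_, inner2_self_eq _, lt_of_le_of_ne
      (add_nonneg (Complex.normSq_nonneg _) (Complex.normSq_nonneg _)) fun h => hu ?_⟩
    rw [← inner2_self_eq_zero, inner2_self_eq, ← h, Complex.ofReal_zero]
  have mulVec_lim : ∀ v, Tendsto (fun n => X n *ᵥ v) atTop (𝓝 (X' *ᵥ v)) := fun v =>
    ((continuous_id.matrix_mulVec continuous_const).tendsto X').comp hX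
  have inner_zero : ∀ u, inner2 u (0 : V2) = 0 := fun u => by simp [inner2]
  have ul := mulVec_lim α
  have vl := mulVec_lim (perp α)
  rw [hα'] at vl
  have fl : Tendsto (fun n => frame (X n *ᵥ α)) atTop (𝓝 (frame (X' *ᵥ α))) :=
    (continuous_frame.tendsto _).comp ul
  have e1 := tendsto_inner2 ul ul
  have e2 := tendsto_inner2 ul vl
  have e3 := tendsto_inner2 ((continuous_perp.tendsto _).comp ul) vl
  rw [hr] at e1
  rw [inner_zero] at e2 e3
  have tl : Tendsto (fun n => (!![inner2 (X n *ᵥ α) (X n *ᵥ α), inner2 (X n *ᵥ α) (X n *ᵥ perp α);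
      0, 1] : M2)) atTop (𝓝 (diagonal ![(r : ℂ), 1])) := by
    refine tendsto_pi_nhds.2 fun i => tendsto_pi_nhds.2 fun j => ?_
    fin_cases i <;> fin_cases j
    · exact e1
    · exact e2
    · exact tendsto_const_nhds
    · exact tendsto_const_nhds
  have fr : frame (X' *ᵥ α) * (frame (X' *ᵥ α))ᴴ = (r : ℂ) • 1 := by
    rw [frame_mul_conjTranspose, hr]
  exact ⟨_, _, _, _, r, hrpos, fl, tl, e3, fun n => conjTranspose_frame_mul _ _, fr⟩

lemma conjTranspose_mul_mul_apply (T P : M8) (I J : I8) :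
    (Tᴴ * P * T) I J = inner8 (T.col I) (P *ᵥ T.col J) := by
  rw [inner8_eq_dotProduct, Matrix.mul_assoc]
  rfl

lemma kron3_frame_col (a b c : V2) (I : I8) :
    (kron3 (frame a) (frame b) (frame c)).col I =
      tp3 (![a, perp a] I.1) (![b, perp b] I.2.1) (![c, perp c] I.2.2) := by
  ext p
  simp [kron3, tp3, frame_apply, Matrix.col]

namespace UPB

variable {U : UPB 4} {A B C : Fin 4 → V2}

lemma inner8_compl_tp3_ne_zero (h : LocalUPB A B C) (hS : ∀ j, U.S j = tp3 (A j) (B j) (C j))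
    {a b c : V2} (ha : a ≠ 0) (hb : b ≠ 0) (hc : c ≠ 0)
    (hk : ∀ k, inner2 (perp a) (A k) = 0 → inner2 (perp b) (B k) = 0 →
      inner2 (perp c) (C k) ≠ 0) :
    inner8 (tp3 a b c) (U.compl *ᵥ tp3 a b c) ≠ 0 := fun h0 => by
  obtain ⟨k, k1, k2, k3⟩ := U.exists_parallel h hS ha hb hc (U.compl_mulVec_eq_zero h0)
  exact hk k k1 k2 k3

lemma inner8_compl (U : UPB 4) (u v : V8) :
    inner8 u (U.compl *ᵥ v) = inner8 u v - ∑ j, inner8 (U.S j) v * inner8 u (U.S j) := by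
  simp [compl_mulVec, inner8_eq_dotProduct, dotProduct_sub, dotProduct_sum]

/-- The entries of the projector in the product frame adapted to one member of the basis. -/
lemma frame_entries (h : LocalUPB A B C) (hS : ∀ j, U.S j = tp3 (A j) (B j) (C j)) (k : Fin 4)
    {T P : M8} (hT : T = kron3 (frame (A k)) (frame (B k)) (frame (C k)))
    (hP : P = Tᴴ * U.compl * T) :
    (∀ I, P I (0, 0, 0) = 0) ∧ P (1, 0, 0) (1, 0, 0) ≠ 0 ∧ P (0, 1, 0) (0, 1, 0) ≠ 0 ∧
      P (0, 0, 1) (0, 0, 1) ≠ 0 ∧ P (1, 0, 0) (0, 1, 0) = 0 ∧ P (1, 0, 0) (0, 0, 1) = 0 ∧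
      P (0, 1, 0) (0, 0, 1) = 0 := by
  have hA := h.ne_zero k
  have hB := h.rotate.ne_zero k
  have hC := h.rotate.rotate.ne_zero k
  have perp_ne : ∀ {u : V2}, u ≠ 0 → perp u ≠ 0 := fun hu => by rwa [Ne, perp_eq_zero]
  have pp_ne : ∀ {u : V2}, inner2 u u = 1 → inner2 (perp (perp u)) u ≠ 0 := fun hu => by
    rw [inner2_perp_perp_self, hu]; norm_num
  have off : ∀ {a b c a' b' c' : V2}, (inner2 a a' = 0 ∨ inner2 b b' = 0 ∨ inner2 c c' = 0) →
      (∀ j, (inner2 (A j) a' = 0 ∨ inner2 (B j) b' = 0 ∨ inner2 (C j) c' = 0) ∨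
        inner2 a (A j) = 0 ∨ inner2 b (B j) = 0 ∨ inner2 c (C j) = 0) →
      inner8 (tp3 a b c) (U.compl *ᵥ tp3 a' b' c') = 0 := fun {a b c a' b' c'} h1 h2 => by
    rw [inner8_compl, inner8_tp3, Finset.sum_eq_zero fun j _ => ?_]
    · simpa [or_assoc] using h1
    · rw [hS, inner8_tp3, inner8_tp3]
      have := h2 j
      simp only [mul_eq_zero]
      tauto
  have self : ∀ u, inner2 u (perp u) = 0 := inner2_perp_self
  have self' : ∀ u, inner2 (perp u) u = 0 := fun u => inner2_comm_eq_zero (self u)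
  have orth : ∀ j, j = k ∨ (inner2 (A j) (A k) = 0 ∧ inner2 (A k) (A j) = 0) ∨
      (inner2 (B j) (B k) = 0 ∧ inner2 (B k) (B j) = 0) ∨
      (inner2 (C j) (C k) = 0 ∧ inner2 (C k) (C j) = 0) := fun j => by
    by_cases hj : j = k
    · exact Or.inl hj
    · rcases h.orth j k hj with o | o | o
      · exact Or.inr (Or.inl ⟨o, inner2_comm_eq_zero o⟩)
      · exact Or.inr (Or.inr (Or.inl ⟨o, inner2_comm_eq_zero o⟩))
      · exact Or.inr (Or.inr (Or.inr ⟨o, inner2_comm_eq_zero o⟩))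
  subst hP hT
  simp only [conjTranspose_mul_mul_apply, kron3_frame_col, Matrix.cons_val_zero,
    Matrix.cons_val_one]
  refine ⟨fun I => ?_, ?_, ?_, ?_, ?_, ?_, ?_⟩
  · rw [← hS, compl_mulVec_self]
    simp [inner8]
  · refine inner8_compl_tp3_ne_zero h hS (perp_ne hA) hB hC fun l l1 l2 l3 => ?_
    rw [← h.rotate.eq_of_parallel l2] at l1
    exact pp_ne (h.normA k) l1
  · refine inner8_compl_tp3_ne_zero h hS hA (perp_ne hB) hC fun l l1 l2 l3 => ?_
    rw [← h.eq_of_parallel l1] at l2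
    exact pp_ne (h.normB k) l2
  · refine inner8_compl_tp3_ne_zero h hS hA hB (perp_ne hC) fun l l1 l2 l3 => ?_
    rw [← h.eq_of_parallel l1] at l3
    exact pp_ne (h.normC k) l3
  · refine off (Or.inl (self' _)) fun j => ?_
    rcases orth j with rfl | o | o | o
    · simp [self]
    all_goals simp [o]
  · refine off (Or.inl (self' _)) fun j => ?_
    rcases orth j with rfl | o | o | o
    · simp [self]
    all_goals simp [o]
  · refine off (Or.inr (Or.inl (self' _))) fun j => ?_
    rcases orth j with rfl | o | o | o
    · simp [self]
    all_goals simp [o]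

open Filter Topology in
/-- Limits of normalized local filterings along degenerating product operators are sums of
product projectors. -/
lemma isProductSum_of_tendsto (U : UPB 4) {X Y Z : ℕ → M2} {X' Y' Z' : M2}
    (hX : Tendsto X atTop (𝓝 X')) (hY : Tendsto Y atTop (𝓝 Y')) (hZ : Tendsto Z atTop (𝓝 Z'))
    (hX0 : X' ≠ 0) (hY0 : Y' ≠ 0) (hZ0 : Z' ≠ 0) (h0 : kron3 X' Y' Z' * U.compl = 0)
    {W : ℕ → M8} (hW : ∀ n, W n = kron3 (X n) (Y n) (Z n) * U.compl * (kron3 (X n) (Y n) (Z n))ᴴ)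
    {W' : M8} (hlim : Tendsto (fun n => (W n).trace⁻¹ • W n) atTop (𝓝 W')) :
    IsProductSum W' := by
  obtain ⟨A, B, C, h, hS⟩ := U.exists_local
  obtain ⟨k, kX, kY, kZ⟩ := U.exists_mulVec_perp_eq_zero h hS hX0 hY0 hZ0 h0
  obtain ⟨F, V, a, F', r, hr, hF, hV, -, eX, hF'⟩ := exists_frames hX hX0 (h.normA k) kX
  obtain ⟨G, V₂, b, G', s, hs, hG, hV₂, hb, eY, hG'⟩ := exists_frames hY hY0 (h.normB k) kY
  obtain ⟨H, V₃, c, H', t, ht, hH, hV₃, hc, eZ, hH'⟩ := exists_frames hZ hZ0 (h.normC k) kZ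
  set T := kron3 (frame (A k)) (frame (B k)) (frame (C k)) with hT
  set P := Tᴴ * U.compl * T with hP
  obtain ⟨p0, px, py, pz, pxy, pxz, pyz⟩ := frame_entries h hS k hT hP
  have hTT : T * Tᴴ = 1 := by
    rw [hT, kron3_conjTranspose, kron3_mul, frame_mul_conjTranspose, frame_mul_conjTranspose,
      frame_mul_conjTranspose, h.normA, h.normB, h.normC]
    simp [kron3_eq_kronecker, Matrix.kronecker]
  have hcompl : U.compl = T * P * Tᴴ := by
    rw [hP]
    simp only [Matrix.mul_assoc, hTT, Matrix.mul_one]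
    rw [← Matrix.mul_assoc T, hTT, Matrix.one_mul]
  let K : ℕ → M8 := fun n => kron3 (F n) (G n) (H n)
  let K' : M8 := kron3 F' G' H'
  let L : ℕ → M8 := fun n => kron3 (V n) (V₂ n) (V₃ n)
  let D : ℕ → M8 := fun n => kron3 (diagonal ![1, a n]) (diagonal ![1, b n]) (diagonal ![1, c n])
  have hKL : ∀ n, (K n)ᴴ * kron3 (X n) (Y n) (Z n) * T = D n * L n := fun n => by
    simp only [K, L, D, hT, kron3_conjTranspose, kron3_mul, eX, eY, eZ]
  have hconj : ∀ n, (K n)ᴴ * W n * K n = D n * (L n * P * (L n)ᴴ) * (D n)ᴴ := fun n => by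
    have e : (K n)ᴴ * W n * K n = (D n * L n) * P * (D n * L n)ᴴ := by
      rw [← hKL, hW, hcompl]
      simp only [Matrix.conjTranspose_mul, Matrix.conjTranspose_conjTranspose, Matrix.mul_assoc]
    rw [e, Matrix.conjTranspose_mul]
    simp only [Matrix.mul_assoc]
  have hK : Tendsto K atTop (𝓝 K') := tendsto_kron3 hF hG hH
  have hL := tendsto_kron3 hV hV₂ hV₃
  have conj_lim : ∀ {M N : ℕ → M8} {M' N' : M8}, Tendsto M atTop (𝓝 M') → Tendsto N atTop (𝓝 N') →
      Tendsto (fun n => M n * N n * (M n)ᴴ) atTop (𝓝 (M' * N' * M'ᴴ)) := fun {M N M' N'} h1 h2 =>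
    (h1.mul h2).mul
      ((continuous_id.matrix_conjTranspose.tendsto M').comp h1)
  have hLP := conj_lim hL (tendsto_const_nhds (x := P))
  have hZ' := conj_lim ((continuous_id.matrix_conjTranspose.tendsto K').comp hK) hlim
  simp only [Function.comp_def, id, Matrix.conjTranspose_conjTranspose] at hZ'
  have hpsd : ∀ n, (W n).PosSemidef := fun n => by
    rw [hW]; exact U.conj_compl_posSemidef _
  have htr : ∀ n, (W n).trace = ((√(W n).trace.re : ℝ) : ℂ) ^ 2 := fun n => by
    have := Complex.nonneg_iff.1 (hpsd n).trace_nonneg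
    rw [← Complex.ofReal_pow, Real.sq_sqrt this.1]
    exact Complex.ext rfl this.2.symm
  have hQ : ∀ I J, (kron3 (diagonal ![(r : ℂ), 1]) (diagonal ![(s : ℂ), 1])
      (diagonal ![(t : ℂ), 1]) * P * (kron3 (diagonal ![(r : ℂ), 1]) (diagonal ![(s : ℂ), 1])
      (diagonal ![(t : ℂ), 1]))ᴴ) I J =
      (![(r : ℂ), 1] I.1 * ![(s : ℂ), 1] I.2.1 * ![(t : ℂ), 1] I.2.2) * P I J *
      star (![(r : ℂ), 1] J.1 * ![(s : ℂ), 1] J.2.1 * ![(t : ℂ), 1] J.2.2) := fun I J => by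
    have hd : kron3 (diagonal ![(r : ℂ), 1]) (diagonal ![(s : ℂ), 1]) (diagonal ![(t : ℂ), 1]) =
        diagonal fun I : I8 => ![(r : ℂ), 1] I.1 * ![(s : ℂ), 1] I.2.1 * ![(t : ℂ), 1] I.2.2 := by
      simp only [kron3_eq_kronecker, Matrix.kronecker, Matrix.diagonal_kronecker_diagonal,
        ← mul_assoc]
    rw [hd, Matrix.diagonal_conjTranspose, Matrix.mul_diagonal, Matrix.diagonal_mul]
    rfl
  obtain ⟨q1, q2, q3, q4⟩ := tendsto_contraction_entries (a := a) (s := fun n => √(W n).trace.re)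
    hLP hZ' hb hc
    (fun n => by rw [← htr, ← hconj, Matrix.mul_smul, Matrix.smul_mul])
    (fun I => by rw [hQ, p0]; simp)
    (by rw [hQ]; simp [px, hs.ne', ht.ne']) (by rw [hQ]; simp [py, hr.ne', ht.ne'])
    (by rw [hQ]; simp [pz, hr.ne', hs.ne']) (by rw [hQ, pxy]; simp) (by rw [hQ, pxz]; simp)
    (by rw [hQ, pyz]; simp)
  have hW'psd : W'.PosSemidef := isClosed_setOf_posSemidef.mem_of_tendsto hlim
    (Eventually.of_forall fun n => (hpsd n).smul (inv_nonneg.2 (hpsd n).trace_nonneg))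
  have hsum := Matrix.PosSemidef.isProductSum (hW'psd.conjTranspose_mul_mul_same K') q1 q2 q3 q4
  have hKK : K' * K'ᴴ = ((r * s * t : ℝ) : ℂ) • 1 := by
    simp only [K', kron3_conjTranspose, kron3_mul, hF', hG', hH', kron3_smul]
    simp [kron3_eq_kronecker, Matrix.kronecker]
  have hfin : W' = (((r * s * t)⁻¹ ^ 2 : ℝ) : ℂ) • (K' * (K'ᴴ * W' * K') * K'ᴴ) := by
    have e : K' * (K'ᴴ * W' * K') * K'ᴴ = (K' * K'ᴴ) * W' * (K' * K'ᴴ) := by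
      simp only [Matrix.mul_assoc]
    have hR : (r * s * t : ℝ) ≠ 0 := by positivity
    rw [e, hKK, Matrix.smul_mul, Matrix.mul_smul, Matrix.one_mul, Matrix.smul_mul, Matrix.mul_one,
      smul_smul, smul_smul, ← Complex.ofReal_mul, ← Complex.ofReal_mul]
    have : (r * s * t)⁻¹ ^ 2 * ((r * s * t) * (r * s * t)) = 1 := by field_simp
    rw [mul_assoc, this, Complex.ofReal_one, one_smul]
  rw [hfin]
  exact (hsum.conj F' G' H').smul (by positivity)

end UPB

/-! ### Local filterings up to scaling -/

open Filter Topology in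
/-- Three sequences of nonzero vectors have normalizations converging along a common subsequence
to nonzero vectors. -/
lemma exists_subseq_tendsto_normalized {E : Type*} [NormedAddCommGroup E] [NormedSpace ℂ E]
    [ProperSpace E] {x y z : ℕ → E} (hx : ∀ n, x n ≠ 0) (hy : ∀ n, y n ≠ 0) (hz : ∀ n, z n ≠ 0) :
    ∃ (φ : ℕ → ℕ) (r s t : ℕ → ℂ) (x' y' z' : E), StrictMono φ ∧
      (∀ n, r n ≠ 0 ∧ s n ≠ 0 ∧ t n ≠ 0) ∧ x' ≠ 0 ∧ y' ≠ 0 ∧ z' ≠ 0 ∧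
      Tendsto (fun n => r n • x (φ n)) atTop (𝓝 x') ∧
      Tendsto (fun n => s n • y (φ n)) atTop (𝓝 y') ∧
      Tendsto (fun n => t n • z (φ n)) atTop (𝓝 z') := by
  have scal : ∀ {v : E}, v ≠ 0 → ((‖v‖⁻¹ : ℝ) : ℂ) ≠ 0 := fun hv =>
    Complex.ofReal_ne_zero.2 (inv_ne_zero (norm_ne_zero_iff.2 hv))
  have unit : ∀ {v : E}, v ≠ 0 → ((‖v‖⁻¹ : ℝ) : ℂ) • v ∈ Metric.sphere (0 : E) 1 := fun {v} hv => by
    rw [mem_sphere_zero_iff_norm, norm_smul, Complex.norm_real, norm_inv, norm_norm,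
      inv_mul_cancel₀ (norm_ne_zero_iff.2 hv)]
  have ne : ∀ {v : E}, v ∈ Metric.sphere (0 : E) 1 → v ≠ 0 := fun hv =>
    ne_zero_of_mem_unit_sphere ⟨_, hv⟩
  have hK := (isCompact_sphere (0 : E) 1).prod
    ((isCompact_sphere (0 : E) 1).prod (isCompact_sphere (0 : E) 1))
  obtain ⟨⟨x', y', z'⟩, ⟨mx, my, mz⟩, φ, hφ, hlim⟩ := hK.tendsto_subseq
    (x := fun n => (((‖x n‖⁻¹ : ℝ) : ℂ) • x n, ((‖y n‖⁻¹ : ℝ) : ℂ) • y n, ((‖z n‖⁻¹ : ℝ) : ℂ) • z n))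
    fun n => ⟨unit (hx n), unit (hy n), unit (hz n)⟩
  have h2 := hlim.snd_nhds
  exact ⟨φ, _, _, _, x', y', z', hφ, fun n => ⟨scal (hx _), scal (hy _), scal (hz _)⟩,
    ne mx, ne my, ne mz, hlim.fst_nhds, h2.fst_nhds, h2.snd_nhds⟩

namespace UPB

lemma mem_MS_iff (U : UPB 4) (ρ : M8) :
    ρ ∈ MS U ↔ ∃ X Y Z : M2,
      (kron3 X Y Z * U.compl * (kron3 X Y Z)ᴴ).trace ≠ 0 ∧
      ρ = (kron3 X Y Z * U.compl * (kron3 X Y Z)ᴴ).trace⁻¹ •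
        (kron3 X Y Z * U.compl * (kron3 X Y Z)ᴴ) := by
  have e : ∀ M : M8, M * upbState U * Mᴴ = (4 : ℂ)⁻¹ • (M * U.compl * Mᴴ) := fun M => by
    rw [upbState_eq, Matrix.mul_smul, Matrix.smul_mul]
  have e' : ∀ M : M8, ((4 : ℂ)⁻¹ • M).trace⁻¹ • (4 : ℂ)⁻¹ • M = M.trace⁻¹ • M := fun M => by
    rw [Matrix.trace_smul, smul_smul, smul_eq_mul, mul_inv, inv_inv]
    congr 1
    ring
  have e'' : ∀ M : M8, 0 < ((4 : ℂ)⁻¹ • (M * U.compl * Mᴴ)).trace.re ↔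
      (M * U.compl * Mᴴ).trace ≠ 0 := fun M => by
    have h0 := (U.conj_compl_posSemidef M).trace_nonneg
    rw [← h0.lt_iff_ne', Complex.pos_iff, Matrix.trace_smul, smul_eq_mul,
      ← Complex.ofReal_ofNat, ← Complex.ofReal_inv, Complex.re_ofReal_mul]
    have := (Complex.nonneg_iff.1 h0).2
    constructor
    · exact fun h => ⟨by linarith, this⟩
    · exact fun h => by linarith [h.1]
  constructor
  · rintro ⟨_, ⟨X, Y, Z, rfl⟩, h, rfl⟩
    rw [e] at h ⊢
    exact ⟨X, Y, Z, (e'' _).1 h, e' _⟩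
  · rintro ⟨X, Y, Z, h, rfl⟩
    refine ⟨_, ⟨X, Y, Z, rfl⟩, ?_, ?_⟩
    · rw [e]; exact (e'' _).2 h
    · rw [e, e']

lemma conj_compl_smul (U : UPB 4) (c : ℂ) (M : M8) :
    c • M * U.compl * (c • M)ᴴ = (c * star c) • (M * U.compl * Mᴴ) := by
  rw [Matrix.conjTranspose_smul, Matrix.mul_smul, Matrix.smul_mul, Matrix.smul_mul, smul_smul,
    mul_comm]

lemma inv_trace_smul_conj_compl_smul (U : UPB 4) {c : ℂ} (hc : c ≠ 0) (M : M8) :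
    (c • M * U.compl * (c • M)ᴴ).trace⁻¹ • (c • M * U.compl * (c • M)ᴴ) =
      (M * U.compl * Mᴴ).trace⁻¹ • (M * U.compl * Mᴴ) := by
  have hc' : c * star c ≠ 0 := mul_ne_zero hc (star_ne_zero.2 hc)
  rw [conj_compl_smul, Matrix.trace_smul, smul_smul, smul_eq_mul, mul_inv, mul_right_comm,
    inv_mul_cancel₀ hc', one_mul]

end UPB

/-- the limit of a convergent sequence in M_S either belongs to M_S
or is a separable state. -/
theorem stmt10 (S : UPB 4) (Y : ℕ → M8) (hY : ∀ n, Y n ∈ MS S) (Yhat : M8)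
    (hconv : Filter.Tendsto Y Filter.atTop (nhds Yhat)) :
    Yhat ∈ MS S ∨ IsSeparable8 Yhat := by
  choose A B C htr hYeq using fun n => (S.mem_MS_iff (Y n)).1 (hY n)
  have ne : ∀ n, A n ≠ 0 ∧ B n ≠ 0 ∧ C n ≠ 0 := fun n => by
    refine ⟨fun h => htr n ?_, fun h => htr n ?_, fun h => htr n ?_⟩ <;>
      simp [h, kron3_eq_kronecker, Matrix.kronecker]
  obtain ⟨φ, r, s, t, A', B', C', hφ, hrst, hA', hB', hC', hA, hB, hC⟩ :=
    exists_subseq_tendsto_normalized (E := Fin 2 → Fin 2 → ℂ)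
      (fun n => (ne n).1) (fun n => (ne n).2.1) (fun n => (ne n).2.2)
  have hK : ∀ n, kron3 (r n • A (φ n)) (s n • B (φ n)) (t n • C (φ n)) =
      (r n * s n * t n) • kron3 (A (φ n)) (B (φ n)) (C (φ n)) := fun n => kron3_smul _ _ _ _ _ _
  let K : ℕ → M8 := fun n => kron3 (r n • A (φ n)) (s n • B (φ n)) (t n • C (φ n))
  let W : ℕ → M8 := fun n => K n * S.compl * (K n)ᴴ
  have hYW : ∀ n, Y (φ n) = (W n).trace⁻¹ • W n := fun n => by
    have hc : r n * s n * t n ≠ 0 :=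
      mul_ne_zero (mul_ne_zero (hrst n).1 (hrst n).2.1) (hrst n).2.2
    simp only [W, K, hK, hYeq (φ n)]
    exact (S.inv_trace_smul_conj_compl_smul hc _).symm
  have hlim : Filter.Tendsto (fun n => (W n).trace⁻¹ • W n) Filter.atTop (nhds Yhat) := by
    simp only [← hYW]
    exact hconv.comp hφ.tendsto_atTop
  have hKlim : Filter.Tendsto K Filter.atTop (nhds (kron3 A' B' C')) := tendsto_kron3 hA hB hC
  have hWlim : Filter.Tendsto W Filter.atTop
      (nhds (kron3 A' B' C' * S.compl * (kron3 A' B' C')ᴴ)) :=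
    (hKlim.mul tendsto_const_nhds).mul
      ((continuous_id.matrix_conjTranspose.tendsto _).comp hKlim)
  have trace_lim : ∀ {M : ℕ → M8} {M' : M8}, Filter.Tendsto M Filter.atTop (nhds M') →
      Filter.Tendsto (fun n => (M n).trace) Filter.atTop (nhds M'.trace) := fun h =>
    (continuous_id.matrix_trace.tendsto _).comp h
  by_cases h0 : (kron3 A' B' C' * S.compl * (kron3 A' B' C')ᴴ).trace = 0
  · right
    rw [S.conj_compl_eq, Matrix.trace_mul_conjTranspose_self_eq_zero_iff] at h0
    refine (S.isProductSum_of_tendsto hA hB hC hA' hB' hC' h0 (W := W) (fun n => rfl)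
      hlim).isSeparable8 ?_
    refine tendsto_nhds_unique (trace_lim hconv) ?_
    refine tendsto_const_nhds.congr fun n => ?_
    rw [hYeq, Matrix.trace_smul, smul_eq_mul, inv_mul_cancel₀ (htr n)]
  · left
    refine (S.mem_MS_iff Yhat).2 ⟨A', B', C', h0, ?_⟩
    exact tendsto_nhds_unique hlim (((trace_lim hWlim).inv₀ h0).smul hWlim)
end
end
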